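/- If the manipulator picks at least once (μ(a₁) ≥ 1), then for every ranking ≻ reported by a₁, u(φ_≻(a₁)) < 2 · u_T; that is, the manipulator cannot increase the utility of her bundle by a multiplicative factor of 2 or more. -/

import Mathlib

/-- One step of the sequential allocation process: an agent with ranking `rk`
(a bijection `Fin m ≃ Fin m`, lower rank = more preferred) greedily picks the
lowest-rank item among the remaining ones (the complement of the already
picked set `S`); if nothing is left, nothing happens. -/
def pickStep {m : ℕ} (rk : Fin m ≃ Fin m) (S : Finset (Fin m)) : Finset (Fin m) :=
  S ∪ Sᶜ.filter fun i => ∀ j ∈ Sᶜ, rk i ≤ rk j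

/-- `pickedUpTo rpt π t` : the set of items picked during the first `t` steps of
the sequential allocation process, where `π` is the (0-indexed) picking sequence
and agent `a` reports the ranking `rpt a`. -/
def pickedUpTo {A : Type*} {m : ℕ} (rpt : A → Fin m ≃ Fin m) (π : ℕ → A) :
    ℕ → Finset (Fin m)
  | 0 => ∅
  | t + 1 => pickStep (rpt (π t)) (pickedUpTo rpt π t)

/-- `alloc rpt π a` : the bundle of items obtained by agent `a` at the end of the
sequential allocation process (which runs for `m` steps). -/
def alloc {A : Type*} [DecidableEq A] {m : ℕ} (rpt : A → Fin m ≃ Fin m)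
    (π : ℕ → A) (a : A) : Finset (Fin m) :=
  (Finset.range m).biUnion fun t =>
    if π t = a then pickedUpTo rpt π (t + 1) \ pickedUpTo rpt π t else ∅

open Finset in
lemma exists_pickStep_eq_insert {m : ℕ} (rk : Fin m ≃ Fin m) {S : Finset (Fin m)}
    {y : Fin m} (hy : y ∉ S) :
    ∃ x ∉ S, (∀ j ∉ S, rk x ≤ rk j) ∧ pickStep rk S = insert x S := by
  obtain ⟨x, hx, hmin⟩ := Finset.exists_min_image Sᶜ rk ⟨y, by simpa using hy⟩
  simp only [mem_compl] at hx hmin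
  refine ⟨x, hx, hmin, ?_⟩
  ext i
  simp only [pickStep, mem_union, mem_filter, mem_compl, mem_insert]
  constructor
  · rintro (h | ⟨h, h'⟩)
    · exact Or.inr h
    · exact Or.inl (rk.injective (le_antisymm (h' x hx) (hmin i h)))
  · rintro (rfl | h)
    · exact Or.inr ⟨hx, hmin⟩
    · exact Or.inl h

lemma subset_pickStep {m : ℕ} (rk : Fin m ≃ Fin m) (S : Finset (Fin m)) :
    S ⊆ pickStep rk S :=
  Finset.subset_union_left

/-- Two picked sets that differ by swapping one item either become equal after a step of the same
picker, or still differ by swapping one item. -/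
lemma pickStep_insert_insert {m : ℕ} (rk : Fin m ≃ Fin m) {D : Finset (Fin m)} {a b : Fin m}
    (hab : a ≠ b) (ha : a ∉ D) (hb : b ∉ D) :
    pickStep rk (insert b D) = pickStep rk (insert a D) ∨
      ∃ D' a' b', D ⊆ D' ∧ a' ≠ b' ∧ a' ∉ D' ∧ b' ∉ D' ∧
        pickStep rk (insert b D) = insert b' D' ∧ pickStep rk (insert a D) = insert a' D' := by
  obtain ⟨x, hx, hxmin, hxe⟩ :=
    exists_pickStep_eq_insert rk (S := insert b D) (y := a) (by simp [hab, ha])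
  obtain ⟨y, hy, hymin, hye⟩ :=
    exists_pickStep_eq_insert rk (S := insert a D) (y := b) (by simp [hab.symm, hb])
  rw [hxe, hye]
  simp only [Finset.mem_insert, not_or] at hx hy hxmin hymin
  by_cases hxa : x = a
  · subst hxa
    by_cases hyb : y = b
    · subst hyb
      exact Or.inl (Finset.insert_comm _ _ _)
    · exact Or.inr ⟨insert x D, y, b, Finset.subset_insert _ _, hyb, by simp [hy], by
        simp [hab.symm, hb], Finset.insert_comm _ _ _, rfl⟩
  · by_cases hyb : y = b
    · subst hyb
      exact Or.inr ⟨insert y D, a, x, Finset.subset_insert _ _, fun h => hxa h.symm, by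
        simp [hab, ha], by simp [hx], rfl, Finset.insert_comm _ _ _⟩
    · have hxy : x = y := rk.injective
        (le_antisymm (hxmin y ⟨hyb, hy.2⟩) (hymin x ⟨hxa, hx.2⟩))
      subst hxy
      exact Or.inr ⟨insert x D, a, b, Finset.subset_insert _ _, hab, by
        simp [ha, Ne.symm hxa], by simp [hb, Ne.symm hyb],
        Finset.insert_comm _ _ _, Finset.insert_comm _ _ _⟩

/-- `Achievable a₁ rk u l S v`: when the items of `S` are gone and `l` lists the pickers still to
come, `a₁` can obtain total utility `v` by freely choosing an available item at each of her turns,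
while the other agents pick greedily according to `rk`. -/
inductive Achievable {A : Type*} {m : ℕ} (a₁ : A) (rk : A → Fin m ≃ Fin m) (u : Fin m → ℝ) :
    List A → Finset (Fin m) → ℝ → Prop
  | nil (S) : Achievable a₁ rk u [] S 0
  | own {l S y v} : y ∉ S → Achievable a₁ rk u l (insert y S) v →
      Achievable a₁ rk u (a₁ :: l) S (u y + v)
  | other {p l S v} : p ≠ a₁ → Achievable a₁ rk u l (pickStep (rk p) S) v →
      Achievable a₁ rk u (p :: l) S v

lemma Achievable.eq_zero {A : Type*} {m : ℕ} {a₁ : A} {rk : A → Fin m ≃ Fin m} {u : Fin m → ℝ}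
    {l : List A} {S : Finset (Fin m)} {v : ℝ} (h : Achievable a₁ rk u l S v) (hl : a₁ ∉ l) :
    v = 0 := by
  induction h with
  | nil => rfl
  | own => simp at hl
  | other _ _ ih => exact ih fun h => hl (List.mem_cons_of_mem _ h)

/-- Swapping one already picked item costs the manipulator at most one item. -/
lemma Achievable.swap {A : Type*} {m : ℕ} {a₁ : A} {rk : A → Fin m ≃ Fin m} {u : Fin m → ℝ}
    (hpos : ∀ i, 0 < u i) {W : ℝ} (hW : 0 ≤ W) {l : List A} {S : Finset (Fin m)} {v : ℝ}
    (h : Achievable a₁ rk u l S v) {D : Finset (Fin m)} {a b : Fin m} (hS : S = insert b D)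
    (hab : a ≠ b) (ha : a ∉ D) (hb : b ∉ D) (hD : ∀ i ∉ D, u i ≤ W) :
    ∃ v', Achievable a₁ rk u l (insert a D) v' ∧ v ≤ v' + W := by
  induction h generalizing D a b with
  | nil => exact ⟨0, .nil _, by simpa using hW⟩
  | @own l S y v hy h ih =>
    subst hS
    by_cases hya : y = a
    · subst hya
      refine ⟨u b + v, .own (by simp [hab.symm, hb]) (Finset.insert_comm b y D ▸ h), ?_⟩
      linarith [hpos b, hD y ha]
    · simp only [Finset.mem_insert, not_or] at hy
      obtain ⟨v', hv', hle⟩ := ih (D := insert y D) (a := a) (b := b) (Finset.insert_comm _ _ _)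
        hab (by simp [ha, Ne.symm hya]) (by simp [hb, Ne.symm hy.1])
        (fun i hi => hD i fun h => hi (Finset.mem_insert_of_mem h))
      exact ⟨u y + v', .own (by simp [hya, hy]) (Finset.insert_comm a y D ▸ hv'), by linarith⟩
  | @other p l S v hp h ih =>
    subst hS
    rcases pickStep_insert_insert (rk p) hab ha hb with
      he | ⟨D', a', b', hsub, hab', ha', hb', hbe, hae⟩
    · exact ⟨v, .other hp (he ▸ h), by linarith⟩
    · obtain ⟨v', hv', hle⟩ := ih hbe hab' ha' hb' fun i hi => hD i fun h => hi (hsub h)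
      exact ⟨v', .other hp (hae ▸ hv'), hle⟩

/-- The utility collected by `a₁` under the reports `rpt`, when the items of `S` are gone and `l`
lists the pickers still to come. -/
def collected {A : Type*} [DecidableEq A] {m : ℕ} (a₁ : A) (rpt : A → Fin m ≃ Fin m)
    (u : Fin m → ℝ) : List A → Finset (Fin m) → ℝ
  | [], _ => 0
  | p :: l, S => (if p = a₁ then ∑ i ∈ pickStep (rpt p) S \ S, u i else 0) +
      collected a₁ rpt u l (pickStep (rpt p) S)

lemma collected_nonneg {A : Type*} [DecidableEq A] {m : ℕ} (a₁ : A) (rpt : A → Fin m ≃ Fin m)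
    {u : Fin m → ℝ} (hpos : ∀ i, 0 < u i) (l : List A) (S : Finset (Fin m)) :
    0 ≤ collected a₁ rpt u l S := by
  induction l generalizing S with
  | nil => exact le_rfl
  | cons p l ih =>
    refine add_nonneg ?_ (ih _)
    split_ifs
    · exact Finset.sum_nonneg fun i _ => (hpos i).le
    · exact le_rfl

lemma achievable_collected {A : Type*} [DecidableEq A] {m : ℕ} (a₁ : A)
    (rk : A → Fin m ≃ Fin m) (u : Fin m → ℝ) (r : Fin m ≃ Fin m) (l : List A)
    (S : Finset (Fin m)) (hS : S.card + l.length ≤ m) :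
    Achievable a₁ rk u l S (collected a₁ (Function.update rk a₁ r) u l S) := by
  induction l generalizing S with
  | nil => exact .nil _
  | cons p l ih =>
    rw [List.length_cons] at hS
    obtain ⟨y, hy⟩ : ∃ y, y ∉ S := by
      by_contra! h
      rw [Finset.eq_univ_of_forall h, Finset.card_univ, Fintype.card_fin] at hS
      omega
    obtain ⟨x, hx, -, he⟩ := exists_pickStep_eq_insert (Function.update rk a₁ r p) hy
    have hrec := ih (insert x S) (by rw [Finset.card_insert_of_notMem hx]; omega)
    rw [collected, he]
    by_cases hp : p = a₁
    · subst hp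
      rw [if_pos rfl, Finset.insert_sdiff_of_notMem _ hx, Finset.sdiff_self, insert_empty_eq,
        Finset.sum_singleton]
      exact .own hx hrec
    · rw [if_neg hp, zero_add]
      rw [Function.update_of_ne hp] at he
      exact .other hp (he ▸ hrec)

lemma Achievable.le_two_mul_collected {A : Type*} [DecidableEq A] {m : ℕ} {a₁ : A}
    {rk : A → Fin m ≃ Fin m} {u : Fin m → ℝ} (hpos : ∀ i, 0 < u i)
    (hT : ∀ i j, rk a₁ i < rk a₁ j ↔ u j < u i) {l : List A} {S : Finset (Fin m)} {v : ℝ}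
    (h : Achievable a₁ rk u l S v) :
    v ≤ 2 * collected a₁ rk u l S ∧ (a₁ ∈ l → v < 2 * collected a₁ rk u l S) := by
  induction l generalizing S v with
  | nil => cases h; simp [collected]
  | cons p l ih =>
    suffices hs : p = a₁ → v < 2 * collected a₁ rk u (p :: l) S by
      by_cases hp : p = a₁
      · exact ⟨(hs hp).le, fun _ => hs hp⟩
      · cases h with
        | own => exact absurd rfl hp
        | other _ h =>
          obtain ⟨h₁, h₂⟩ := ih h
          rw [collected, if_neg hp, zero_add]
          exact ⟨h₁, fun hm => h₂ ((List.mem_cons.1 hm).resolve_left (Ne.symm hp))⟩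
    rintro rfl
    cases h with
    | other hp => exact absurd rfl hp
    | @own _ _ y w hy h =>
      obtain ⟨x, hx, hmin, he⟩ := exists_pickStep_eq_insert (rk p) hy
      have hbest : ∀ j ∉ S, u j ≤ u x := fun j hj =>
        not_lt.1 fun hlt => (hmin j hj).not_gt ((hT j x).2 hlt)
      rw [collected, he, if_pos rfl, Finset.insert_sdiff_of_notMem _ hx, Finset.sdiff_self,
        insert_empty_eq, Finset.sum_singleton]
      have hyx := hbest y hy
      have hx0 := hpos x
      by_cases hl : p ∈ l
      · by_cases hxy : x = y
        · subst hxy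
          linarith [(ih h).1]
        · obtain ⟨w', hw', hle⟩ := h.swap hpos hx0.le rfl hxy hx hy hbest
          linarith [(ih hw').2 hl]
      · linarith [h.eq_zero hl, collected_nonneg p rk hpos l (insert x S)]

lemma pickedUpTo_mono {A : Type*} {m : ℕ} (rpt : A → Fin m ≃ Fin m) (π : ℕ → A) :
    Monotone (pickedUpTo rpt π) :=
  monotone_nat_of_le_succ fun _ => subset_pickStep _ _

lemma collected_map_range' {A : Type*} [DecidableEq A] {m : ℕ} (a₁ : A)
    (rpt : A → Fin m ≃ Fin m) (π : ℕ → A) (u : Fin m → ℝ) (n t : ℕ) :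
    collected a₁ rpt u ((List.range' t n).map π) (pickedUpTo rpt π t) =
      ∑ s ∈ Finset.range n, if π (t + s) = a₁ then
        ∑ i ∈ pickedUpTo rpt π (t + s + 1) \ pickedUpTo rpt π (t + s), u i else 0 := by
  induction n generalizing t with
  | zero => simp [collected]
  | succ n ih =>
    rw [List.range'_succ, List.map_cons, collected, Finset.sum_range_succ', add_comm]
    have h := ih (t + 1)
    simp only [add_assoc, add_comm 1] at h
    exact congrArg₂ (· + ·) (h.trans (by simp [add_assoc])) rfl

lemma sum_alloc {A : Type*} [DecidableEq A] {m : ℕ} (a₁ : A)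
    (rpt : A → Fin m ≃ Fin m) (π : ℕ → A) (u : Fin m → ℝ) :
    ∑ i ∈ alloc rpt π a₁, u i = collected a₁ rpt u ((List.range' 0 m).map π) ∅ := by
  have h := collected_map_range' a₁ rpt π u m 0
  rw [pickedUpTo] at h
  have hdisj : Pairwise fun s t => Disjoint
      (if π s = a₁ then pickedUpTo rpt π (s + 1) \ pickedUpTo rpt π s else ∅)
      (if π t = a₁ then pickedUpTo rpt π (t + 1) \ pickedUpTo rpt π t else ∅) := by
    refine (pairwise_disjoint_on _).2 fun s t hst => ?_
    have hd : Disjoint (pickedUpTo rpt π (s + 1) \ pickedUpTo rpt π s)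
        (pickedUpTo rpt π (t + 1) \ pickedUpTo rpt π t) := Finset.disjoint_sdiff.mono_left
      (Finset.sdiff_subset.trans (pickedUpTo_mono rpt π (Nat.succ_le_of_lt hst)))
    split_ifs <;> simp [hd]
  rw [h, alloc, Finset.sum_biUnion fun s _ t _ hst => hdisj hst]
  refine Finset.sum_congr rfl fun t _ => ?_
  rw [zero_add]
  split_ifs <;> simp

/-- if the manipulator `a₁` picks at least once (`μ(a₁) ≥ 1`), then
for every ranking `r` she reports, `u(φ_r(a₁)) < 2 · u_T`.  Here `rk` are the
truthful rankings, `u` is the manipulator's injective positive utility function,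
consistent with her truthful ranking (`rk a₁ i < rk a₁ j ↔ u j < u i`), and
`u_T` is the utility of her bundle when reporting truthfully. -/
theorem statement13 {A : Type*} [DecidableEq A] {m : ℕ} (a₁ : A)
    (rk : A → Fin m ≃ Fin m) (π : ℕ → A) (u : Fin m → ℝ)
    (hpos : ∀ i, 0 < u i) (hinj : Function.Injective u)
    (hT : ∀ i j, rk a₁ i < rk a₁ j ↔ u j < u i)
    (hμ : 1 ≤ ((Finset.range m).filter fun t => π t = a₁).card)
    (r : Fin m ≃ Fin m) :
    ∑ i ∈ alloc (Function.update rk a₁ r) π a₁, u i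
      < 2 * ∑ i ∈ alloc rk π a₁, u i := by
  rw [sum_alloc, sum_alloc]
  refine ((achievable_collected a₁ rk u r _ ∅ (by simp)).le_two_mul_collected hpos hT).2 ?_
  obtain ⟨t, ht⟩ := Finset.card_pos.1 hμ
  simp only [Finset.mem_filter, Finset.mem_range] at ht
  exact List.mem_map.2 ⟨t, by simp [List.mem_range'_1, ht.1], ht.2⟩
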